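/- arXiv:2307.10552 — 4 statements merged into one kernel-verified Lean document; each statement's English description precedes it below -/
import Mathlib

section
/- For any suff-match w and any match v such that c_v = c_w, d̂_v = d̂_w, and â_v < â_w, the match v is also a suff-match. -/
open scoped Classical

namespace MCSPaper

variable {α : Type*}

/-- `Z` is a common subsequence of `X` and `Y` (i.e. `X` and `Y` share `Z`). -/
def Shares (X Y Z : List α) : Prop := Z.Sublist X ∧ Z.Sublist Y

/-- `Z` is a maximal common subsequence of `X` and `Y`: it is a common
subsequence and no single-character insertion yields a common subsequence. -/
def IsMCS (X Y Z : List α) : Prop :=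
  Shares X Y Z ∧
    ∀ k, k ≤ Z.length → ∀ c : α, ¬ Shares X Y (Z.take k ++ c :: Z.drop k)

/-- `w = (i, j)` is a match: `1 ≤ i ≤ |X|`, `1 ≤ j ≤ |Y|`, `X[i] = Y[j]`
(1-based indexing). -/
def IsMatch (X Y : List α) (w : ℕ × ℕ) : Prop :=
  1 ≤ w.1 ∧ w.1 ≤ X.length ∧ 1 ≤ w.2 ∧ w.2 ≤ Y.length ∧
    ∃ c : α, X[w.1 - 1]? = some c ∧ Y[w.2 - 1]? = some c

/-- `c_w = c`, i.e. `X[i_w] = Y[j_w] = c` (1-based indexing). -/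
def MatchChar (X Y : List α) (w : ℕ × ℕ) (c : α) : Prop :=
  X[w.1 - 1]? = some c ∧ Y[w.2 - 1]? = some c

/-- `pref(Z)`: componentwise least 1-based indices `(i, j)` such that
`X[1..i]` and `Y[1..j]` contain `Z` as a subsequence; `pref(ε) = (0,0)`. -/
noncomputable def prefPair (X Y Z : List α) : ℕ × ℕ :=
  (sInf {i | Z.Sublist (X.take i)}, sInf {j | Z.Sublist (Y.take j)})

/-- `suff(Z)`: componentwise greatest 1-based indices `(i, j)` such that
`X[i..|X|]` and `Y[j..|Y|]` contain `Z` as a subsequence;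
`suff(ε) = (|X|+1, |Y|+1)`. -/
noncomputable def suffPair (X Y Z : List α) : ℕ × ℕ :=
  (sSup {i | i ≤ X.length + 1 ∧ Z.Sublist (X.drop (i - 1))},
   sSup {j | j ≤ Y.length + 1 ∧ Z.Sublist (Y.drop (j - 1))})

/-- `u < v` componentwise strictly. -/
def pLt (u v : ℕ × ℕ) : Prop := u.1 < v.1 ∧ u.2 < v.2

/-- `u ≤ v` componentwise. -/
def pLe (u v : ℕ × ℕ) : Prop := u.1 ≤ v.1 ∧ u.2 ≤ v.2

/-- `u ⪇ v`: `u ≤ v` componentwise and `u ≠ v`. -/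
def pLneq (u v : ℕ × ℕ) : Prop := pLe u v ∧ u ≠ v

/-- `u ≺ v`: `u < v` and there is no match `w` with `u < w < v`. -/
def pPrec (X Y : List α) (u v : ℕ × ℕ) : Prop :=
  pLt u v ∧ ¬ ∃ w, IsMatch X Y w ∧ pLt u w ∧ pLt w v

/-- `w` is a suff-match: `w = suff(Z)` for some nonempty shared `Z`. -/
def IsSuffMatch (X Y : List α) (w : ℕ × ℕ) : Prop :=
  ∃ Z : List α, Z ≠ [] ∧ Shares X Y Z ∧ suffPair X Y Z = w

/-- `w` is a pref-match: `w = pref(Z)` for some nonempty shared `Z`. -/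
def IsPrefMatch (X Y : List α) (w : ℕ × ℕ) : Prop :=
  ∃ Z : List α, Z ≠ [] ∧ Shares X Y Z ∧ prefPair X Y Z = w

/-- `next_W(c, h)`: least `h'` with `h < h' ≤ |W|` and `W[h'] = c`,
or `|W| + 1` if none (1-based). -/
noncomputable def nextIdx (W : List α) (c : α) (h : ℕ) : ℕ :=
  sInf ({h' | h < h' ∧ W[h' - 1]? = some c} ∪ {W.length + 1})

/-- `prev_W(c, h)`: greatest `h'` with `1 ≤ h' < h` and `W[h'] = c`,
or `0` if none (1-based). -/
noncomputable def prevIdx (W : List α) (c : α) (h : ℕ) : ℕ :=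
  sSup {h' | 1 ≤ h' ∧ h' < h ∧ W[h' - 1]? = some c}

/-- `next(c, w) = (next_X(c, i_w), next_Y(c, j_w))`. -/
noncomputable def nextPair (X Y : List α) (c : α) (w : ℕ × ℕ) : ℕ × ℕ :=
  (nextIdx X c w.1, nextIdx Y c w.2)

/-- `prev(c, w) = (prev_X(c, i_w), prev_Y(c, j_w))`. -/
noncomputable def prevPair (X Y : List α) (c : α) (w : ℕ × ℕ) : ℕ × ℕ :=
  (prevIdx X c w.1, prevIdx Y c w.2)

/-- `Z'` is a prefix of some MCS of `X` and `Y`. -/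
def IsMCSPrefix (X Y Z' : List α) : Prop :=
  ∃ M, IsMCS X Y M ∧ Z' <+: M

/-- `c` is `Z'`-extensible: `Z' ∘ c` is an MCS-prefix. -/
def Extensible (X Y Z' : List α) (c : α) : Prop :=
  IsMCSPrefix X Y (Z' ++ [c])

/-- `Zs` is a single-character insertion derivative of `Z` (shared by `X`, `Y`). -/
def IsDeriv (X Y Z Zs : List α) : Prop :=
  ∃ k, k ≤ Z.length ∧ ∃ c : α, Zs = Z.take k ++ c :: Z.drop k ∧ Shares X Y Zs

/-- `safe(Z')` as in Conte et al. -/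
noncomputable def safePair (X Y Z' : List α) : ℕ × ℕ :=
  (sInf ({i | ∃ Zs, IsDeriv X Y Z' Zs ∧
      prefPair X Y Zs = (i, (prefPair X Y Z').2)} ∪ {X.length + 1}),
   sInf ({j | ∃ Zs, IsDeriv X Y Z' Zs ∧
      prefPair X Y Zs = ((prefPair X Y Z').1, j)} ∪ {Y.length + 1}))

/-- `v` is a `c`-witness of `Z'`-extensibility. -/
def IsCWitness (X Y Z' : List α) (c : α) (v : ℕ × ℕ) : Prop :=
  IsSuffMatch X Y v ∧ pPrec X Y (prefPair X Y Z') v ∧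
    pLe v (safePair X Y Z') ∧ MatchChar X Y v c

/-- `v` is a witness of `Z'`-extensibility. -/
def IsWitness (X Y Z' : List α) (v : ℕ × ℕ) : Prop :=
  ∃ c, IsCWitness X Y Z' c v

/-- `v` is a prominent witness of `Z'`-extensibility. -/
def Prominent (X Y Z' : List α) (v : ℕ × ℕ) : Prop :=
  IsWitness X Y Z' v ∧ ¬ ∃ v', IsWitness X Y Z' v' ∧ pLneq v' v

/-- `Suff_i[j]`: least `i'` with `i ≤ i' ≤ |X|` such that `(i', j)` is a
suff-match, or `|X| + 1` if none. -/
noncomputable def SuffSeq (X Y : List α) (i j : ℕ) : ℕ :=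
  sInf ({i' | i ≤ i' ∧ i' ≤ X.length ∧ IsSuffMatch X Y (i', j)} ∪ {X.length + 1})

/-- `î`: number of indices `i'` with `1 ≤ i' ≤ i` and `X[i'] = c`. -/
def hatI [DecidableEq α] (X : List α) (c : α) (i : ℕ) : ℕ :=
  (X.take i).count c

/-- `ĵ`: number of indices `j'` with `1 ≤ j' ≤ j` and `Y[j'] = c`. -/
def hatJ [DecidableEq α] (Y : List α) (c : α) (j : ℕ) : ℕ :=
  (Y.take j).count c

/-- Sentinel assumptions: `Σ = {1, …, σ}`, `X[1] = Y[1] = 1`,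
`X[|X|] = Y[|Y|] = σ`, and the inner characters lie in `{2, …, σ−1}`. -/
def Sentinel (X Y : List ℕ) (σ : ℕ) : Prop :=
  X ≠ [] ∧ Y ≠ [] ∧ X.head? = some 1 ∧ Y.head? = some 1 ∧
    X.getLast? = some σ ∧ Y.getLast? = some σ ∧
    (∀ c ∈ (X.drop 1).dropLast, 2 ≤ c ∧ c ≤ σ - 1) ∧
    (∀ c ∈ (Y.drop 1).dropLast, 2 ≤ c ∧ c ≤ σ - 1)

/-- `i` is the greatest 1-based index such that `W[i..|W|]` contains `Z` as a subsequence. -/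
def IsLastStart (W Z : List α) (i : ℕ) : Prop :=
  1 ≤ i ∧ Z.Sublist (W.drop (i - 1)) ∧ ¬ Z.Sublist (W.drop i)

theorem isLastStart_sSup {W Z : List α} (hZ : Z ≠ []) (h : Z.Sublist W) :
    IsLastStart W Z (sSup {i | i ≤ W.length + 1 ∧ Z.Sublist (W.drop (i - 1))}) := by
  set S := {i | i ≤ W.length + 1 ∧ Z.Sublist (W.drop (i - 1))}
  have hbdd : BddAbove S := ⟨W.length + 1, fun i hi => hi.1⟩
  have h1 : 1 ∈ S := ⟨by omega, by simpa using h⟩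
  have hmem : sSup S ∈ S := Nat.sSup_mem ⟨1, h1⟩ hbdd
  refine ⟨le_csSup hbdd h1, hmem.2, fun hs => ?_⟩
  have hlt : sSup S < W.length := by
    by_contra hle
    rw [List.drop_eq_nil_of_le (not_lt.mp hle)] at hs
    exact hZ (List.sublist_nil.mp hs)
  have : sSup S + 1 ≤ sSup S :=
    le_csSup hbdd ⟨by omega, by simpa using hs⟩
  omega

theorem IsLastStart.sSup_eq {W Z : List α} {i : ℕ} (h : IsLastStart W Z i)
    (hi : i ≤ W.length) :
    sSup {i | i ≤ W.length + 1 ∧ Z.Sublist (W.drop (i - 1))} = i := by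
  refine IsGreatest.csSup_eq ⟨⟨by omega, h.2.1⟩, fun j hj => ?_⟩
  by_contra hlt
  exact h.2.2 (hj.2.trans (List.drop_sublist_drop_left W (by omega)))

theorem IsLastStart.sublist {W Z : List α} {i : ℕ} (h : IsLastStart W Z i) :
    Z.Sublist W :=
  h.2.1.trans (List.drop_sublist _ _)

/-- Prepending `k` copies of `c` moves the last start back by `k` occurrences of `c`. -/
theorem IsLastStart.replicate_append [DecidableEq α] {W Z : List α} {c : α} {i j k : ℕ}
    (h : IsLastStart W Z i) (hi : W[i - 1]? = some c) (hj1 : 1 ≤ j) (hj : W[j - 1]? = some c)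
    (hcount : (W.take i).count c = (W.take j).count c + k) :
    IsLastStart W (List.replicate k c ++ Z) j := by
  obtain ⟨hi1, hsub, hnot⟩ := h
  obtain ⟨b, rfl⟩ : ∃ b, i = b + 1 := ⟨i - 1, by omega⟩
  obtain ⟨a, rfl⟩ : ∃ a, j = a + 1 := ⟨j - 1, by omega⟩
  simp only [Nat.add_sub_cancel] at hi hj hsub
  have hb : (W.take (b + 1)).count c = (W.take b).count c + 1 := by
    rw [List.take_add_one, hi]; simp
  have ha : (W.take (a + 1)).count c = (W.take a).count c + 1 := by
    rw [List.take_add_one, hj]; simp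
  have mono : ∀ m n, m ≤ n → (W.take m).count c ≤ (W.take n).count c := fun m n hmn =>
    (List.take_sublist_take_left hmn).count_le c
  refine ⟨by omega, ?_, fun hs => ?_⟩
  · have hab : a ≤ b := by
      by_contra hlt
      have := mono (b + 1) a (by omega)
      omega
    obtain ⟨d, rfl⟩ := Nat.exists_eq_add_of_le hab
    rw [Nat.add_sub_cancel, ← List.take_append_drop d (W.drop a), List.drop_drop]
    refine List.Sublist.append (List.replicate_sublist_iff.mpr ?_) hsub
    have := congrArg (List.count c) (List.take_add (l := W) (i := a) (j := d))
    rw [List.count_append] at this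
    omega
  · obtain ⟨r₁, r₂, hr, hr₁, hr₂⟩ := List.append_sublist_iff.mp hs
    have hk := List.replicate_sublist_iff.mp hr₁
    have hdrop : r₂ = W.drop (a + 1 + r₁.length) := by
      rw [← List.drop_drop, hr, List.drop_left]
    have htake : W.take (a + 1 + r₁.length) = W.take (a + 1) ++ r₁ := by
      rw [List.take_add, hr, List.take_left]
    have hc := congrArg (List.count c) htake
    rw [List.count_append] at hc
    by_cases hle : a + 1 + r₁.length ≤ b
    · have := mono _ _ hle
      omega
    · rw [hdrop] at hr₂
      exact hnot (hr₂.trans (List.drop_sublist_drop_left W (by omega)))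

theorem statement14 {α : Type*} [DecidableEq α] (X Y : List α)
    (hX : X ≠ []) (hY : Y ≠ [])
    (w v : ℕ × ℕ) (hw : IsSuffMatch X Y w) (hv : IsMatch X Y v) (c : α)
    (hcw : MatchChar X Y w c) (hcv : MatchChar X Y v c)
    (hd : (hatJ Y c v.2 : ℤ) - hatI X c v.1 = (hatJ Y c w.2 : ℤ) - hatI X c w.1)
    (ha : hatI X c v.1 + hatJ Y c v.2 < hatI X c w.1 + hatJ Y c w.2) :
    IsSuffMatch X Y v := by
  obtain ⟨Z, hZ, ⟨hZX, hZY⟩, rfl⟩ := hw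
  obtain ⟨v₁, v₂⟩ := v
  obtain ⟨hv1, hv1', hv2, hv2', -⟩ := hv
  set w := suffPair X Y Z
  simp only [hatI, hatJ] at hd ha
  have h₁ := (isLastStart_sSup hZ hZX).replicate_append (i := w.1) (j := v₁)
    (k := (X.take w.1).count c - (X.take v₁).count c) hcw.1 hv1 hcv.1 (by omega)
  have h₂ := (isLastStart_sSup hZ hZY).replicate_append (i := w.2) (j := v₂)
    (k := (X.take w.1).count c - (X.take v₁).count c) hcw.2 hv2 hcv.2 (by omega)
  exact ⟨_, by simp [hZ], ⟨h₁.sublist, h₂.sublist⟩,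
    Prod.ext (h₁.sSup_eq hv1') (h₂.sSup_eq hv2')⟩

end MCSPaper
end

section
/- Under the sentinel assumptions, for any nonempty MCS-prefix Z' admitting at least one Z'-extensible character, the number of Z'-extensible character candidates is strictly less than step(Z'). -/
open scoped Classical

namespace MCSPaper

variable {α : Type*}

/-- The shortest prefix of `X` containing `Z ++ [c]` ends with `c`, and what precedes its last
character contains `Z`. -/
theorem sInf_sublist_take_append_singleton {X Z : List α} {c : α} (h : (Z ++ [c]).Sublist X) :
    ∃ m, sInf {i | (Z ++ [c]).Sublist (X.take i)} = m + 1 ∧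
      sInf {i | Z.Sublist (X.take i)} ≤ m ∧ X[m]? = some c := by
  have hne : {i | (Z ++ [c]).Sublist (X.take i)}.Nonempty := ⟨X.length, by simpa using h⟩
  have hmem := Nat.sInf_mem hne
  rcases hn : sInf {i | (Z ++ [c]).Sublist (X.take i)} with _ | m
  · rw [hn] at hmem
    simp at hmem
  · rw [hn, Set.mem_ofPred_eq] at hmem
    have hnot : ¬ (Z ++ [c]).Sublist (X.take m) := fun h' => by
      have := Nat.sInf_le (s := {i | (Z ++ [c]).Sublist (X.take i)}) h'
      omega
    rw [List.take_add_one] at hmem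
    rcases hx : X[m]? with _ | x
    · simp [hx] at hmem
      exact absurd hmem hnot
    · rw [hx] at hmem
      have hrev := hmem.reverse
      simp only [Option.toList_some, List.reverse_append, List.reverse_singleton,
        List.singleton_append] at hrev
      cases hrev with
      | cons _ h' =>
        refine absurd ?_ hnot
        rw [← List.reverse_sublist]
        simpa using h'
      | cons_cons _ h' =>
        exact ⟨m, rfl, Nat.sInf_le (List.reverse_sublist.1 h'), hx⟩

/-- A character occurring after the shortest prefix of `X` containing `Z` extends `Z` to a
subsequence of `X`. -/
theorem append_singleton_sublist_of_mem_drop {X Z : List α} {c : α} (h : Z.Sublist X)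
    (hc : c ∈ X.drop (sInf {i | Z.Sublist (X.take i)})) : (Z ++ [c]).Sublist X := by
  have hmem : Z.Sublist (X.take (sInf {i | Z.Sublist (X.take i)})) :=
    Nat.sInf_mem (s := {i | Z.Sublist (X.take i)}) ⟨X.length, by simpa using h⟩
  simpa using hmem.append (List.singleton_sublist.2 hc)

theorem Shares.of_prefix {X Y Z M : List α} (hM : Shares X Y M) (h : Z <+: M) : Shares X Y Z :=
  ⟨h.sublist.trans hM.1, h.sublist.trans hM.2⟩

theorem lt_length_of_getElem?_eq_some {X : List α} {m : ℕ} {c : α} (h : X[m]? = some c) :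
    m < X.length :=
  (List.getElem?_eq_some_iff.1 h).1

theorem statement15 (X Y : List ℕ) (σ : ℕ) (hsen : Sentinel X Y σ)
    (Z' : List ℕ) (hZ' : Z' ≠ []) (hpre : IsMCSPrefix X Y Z')
    (hext : ∃ c, Extensible X Y Z' c) :
    {c : ℕ | c ∈ X.drop (prefPair X Y Z').1 ∧ c ∈ Y.drop (prefPair X Y Z').2 ∧
        pPrec X Y (prefPair X Y Z') (prefPair X Y (Z' ++ [c]))}.encard <
      ((sInf {d : ℕ | ∃ c, Extensible X Y Z' c ∧
          d = (prefPair X Y (Z' ++ [c])).1 + (prefPair X Y (Z' ++ [c])).2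
            - ((prefPair X Y Z').1 + (prefPair X Y Z').2)} : ℕ) : ℕ∞) := by
  obtain ⟨M, hM, hZM⟩ := hpre
  have hZ := hM.1.of_prefix hZM
  obtain ⟨e, ⟨N, hN, heN⟩, hstep⟩ := Nat.sInf_mem (s := {d : ℕ | ∃ c, Extensible X Y Z' c ∧
    d = (prefPair X Y (Z' ++ [c])).1 + (prefPair X Y (Z' ++ [c])).2
      - ((prefPair X Y Z').1 + (prefPair X Y Z').2)}) (hext.imp' _ fun c hc => ⟨c, hc, rfl⟩)
  rw [hstep]
  have hZe := hN.1.of_prefix heN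
  obtain ⟨m, hm, him, hXm⟩ := sInf_sublist_take_append_singleton hZe.1
  obtain ⟨n, hn, hjn, hYn⟩ := sInf_sublist_take_append_singleton hZe.2
  have hpe : prefPair X Y (Z' ++ [e]) = (m + 1, n + 1) := Prod.ext hm hn
  obtain ⟨i, hi⟩ : ∃ i, sInf {i | Z'.Sublist (X.take i)} = i := ⟨_, rfl⟩
  obtain ⟨j, hj⟩ : ∃ j, sInf {j | Z'.Sublist (Y.take j)} = j := ⟨_, rfl⟩
  have hp : prefPair X Y Z' = (i, j) := Prod.ext hi hj
  rw [hi] at him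
  rw [hj] at hjn
  simp only [hpe, hp]
  let S : Finset ℕ := insert e
    ((Finset.Ico i m).image (fun k => X.getD k 0) ∪ (Finset.Ico j n).image (fun k => Y.getD k 0))
  have hS : S.card ≤ (m - i) + (n - j) + 1 := by
    refine (Finset.card_insert_le _ _).trans (Nat.succ_le_succ ((Finset.card_union_le _ _).trans ?_))
    exact add_le_add (Finset.card_image_le.trans (by simp)) (Finset.card_image_le.trans (by simp))
  refine (Set.encard_le_encard (t := (S : Set ℕ)) ?_).trans_lt ?_
  · rintro c ⟨hcX, hcY, -, hprec⟩
    obtain ⟨a, ha, hia, hXa⟩ := sInf_sublist_take_append_singleton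
      (append_singleton_sublist_of_mem_drop hZ.1 (hi ▸ hcX))
    obtain ⟨b, hb, hjb, hYb⟩ := sInf_sublist_take_append_singleton
      (append_singleton_sublist_of_mem_drop hZ.2 (hj ▸ hcY))
    rw [hi] at hia
    rw [hj] at hjb
    have hpc : prefPair X Y (Z' ++ [c]) = (a + 1, b + 1) := Prod.ext ha hb
    rw [hpc] at hprec
    simp only [S, Finset.coe_insert, Finset.coe_union, Finset.coe_image, Set.mem_insert_iff,
      Set.mem_union, Set.mem_image, Finset.coe_Ico, Set.mem_Ico]
    by_cases hce : c = e
    · exact Or.inl hce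
    refine Or.inr ?_
    have ham : a ≠ m := by
      rintro rfl
      exact hce (Option.some.inj (hXa.symm.trans hXm))
    have hbn : b ≠ n := by
      rintro rfl
      exact hce (Option.some.inj (hYb.symm.trans hYn))
    by_cases h1 : a < m
    · exact Or.inl ⟨a, ⟨hia, h1⟩, by simp [hXa]⟩
    by_cases h2 : b < n
    · exact Or.inr ⟨b, ⟨hjb, h2⟩, by simp [hYb]⟩
    have hmX := lt_length_of_getElem?_eq_some hXm
    have hnY := lt_length_of_getElem?_eq_some hYn
    refine absurd ⟨(m + 1, n + 1), ⟨?_, ?_, ?_, ?_, e, hXm, hYn⟩, ⟨?_, ?_⟩, ⟨?_, ?_⟩⟩ hprec <;>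
      simp only <;> omega
  · rw [Set.encard_coe_eq_coe_finsetCard]
    exact_mod_cast (by omega : S.card < m + 1 + (n + 1) - (i + j))

end MCSPaper
end

section
/- Under the sentinel assumptions, for any nonempty MCS-prefix Z', every Z'-extensible character is a Z'-extensible character candidate; that is, if c is Z'-extensible then both X[i_{pref(Z')}+1..|X|] and Y[j_{pref(Z')}+1..|Y|] contain c and pref(Z') ≺ pref(Z'∘c). -/
open scoped Classical

namespace MCSPaper

variable {α : Type*}

/-- The length of the shortest prefix of `W` containing `Z` as a subsequence. -/
noncomputable def prefLength (W Z : List α) : ℕ := sInf {i | Z.Sublist (W.take i)}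

theorem prefLength_le {W Z : List α} {i : ℕ} (h : Z.Sublist (W.take i)) :
    prefLength W Z ≤ i :=
  Nat.sInf_le h

theorem sublist_take_prefLength {W Z : List α} (h : Z.Sublist W) :
    Z.Sublist (W.take (prefLength W Z)) :=
  Nat.sInf_mem (s := {i | Z.Sublist (W.take i)}) ⟨W.length, by simpa using h⟩

theorem prefLength_lt_append_singleton {W Z : List α} {c : α} (h : (Z ++ [c]).Sublist W) :
    prefLength W Z < prefLength W (Z ++ [c]) := by
  obtain ⟨l₁, l₂, hl, h₁, h₂⟩ :=
    List.append_sublist_iff.mp (sublist_take_prefLength h)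
  have hlen := congrArg List.length hl
  have hpos : 0 < l₂.length := h₂.length_le
  rw [List.length_append, List.length_take] at hlen
  have htake : W.take l₁.length = l₁ := by
    have h' : l₁ <+: W := (List.prefix_append l₁ l₂).trans (hl ▸ List.take_prefix _ W)
    exact (List.prefix_iff_eq_take.mp h').symm
  have := prefLength_le (W := W) (i := l₁.length) (htake.symm ▸ h₁)
  omega

/-- Cutting `W` before the shortest prefix containing `Z ∘ c` leaves `c ∘ T` in the remainder. -/
theorem cons_sublist_drop {W Z T : List α} {c : α} {i : ℕ}
    (h : (Z ++ c :: T).Sublist W) (hi : i < prefLength W (Z ++ [c])) :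
    (c :: T).Sublist (W.drop i) := by
  rw [← List.take_append_drop i W] at h
  obtain ⟨l₁, l₂, hl, h₁, h₂⟩ := List.sublist_append_iff.mp h
  rcases List.append_eq_append_iff.mp hl with ⟨a, rfl, ha⟩ | ⟨a, rfl, rfl⟩
  · cases a with
    | nil => exact (List.nil_append l₂ ▸ ha) ▸ h₂
    | cons b a =>
      obtain ⟨rfl, rfl⟩ := List.cons.inj ha
      have h' : (Z ++ [c]).Sublist (Z ++ c :: a) := by simp
      exact absurd (prefLength_le (h'.trans h₁)) (by omega)
  · exact (List.sublist_append_right a _).trans h₂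

/-- A character strictly between the ends of the shortest prefixes containing `Z` and `Z ∘ c`
can be inserted after `Z`. -/
theorem insert_sublist {W Z T : List α} {c d : α} {i : ℕ}
    (h : (Z ++ c :: T).Sublist W) (hZ : prefLength W Z < i)
    (hi : i < prefLength W (Z ++ [c])) (hd : W[i - 1]? = some d) :
    (Z ++ d :: c :: T).Sublist W := by
  obtain ⟨k, rfl⟩ : ∃ k, i = k + 1 := ⟨i - 1, by omega⟩
  have hZW : Z.Sublist (W.take k) :=
    (sublist_take_prefLength ((List.sublist_append_left Z _).trans h)).trans
      (List.take_sublist_take_left (by omega))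
  have hZd : (Z ++ [d]).Sublist (W.take (k + 1)) := by
    rw [List.take_add_one, show W[k]? = some d from hd]
    exact hZW.append (List.Sublist.refl _)
  have := hZd.append (cons_sublist_drop h hi)
  rwa [List.take_append_drop, List.append_assoc] at this

theorem statement16 (X Y : List ℕ) (σ : ℕ) (hsen : Sentinel X Y σ)
    (Z' : List ℕ) (hZ' : Z' ≠ []) (hpre : IsMCSPrefix X Y Z') (c : ℕ)
    (hc : Extensible X Y Z' c) :
    c ∈ X.drop (prefPair X Y Z').1 ∧ c ∈ Y.drop (prefPair X Y Z').2 ∧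
      pPrec X Y (prefPair X Y Z') (prefPair X Y (Z' ++ [c])) := by
  obtain ⟨M, ⟨⟨hX, hY⟩, hmax⟩, T, rfl⟩ := hc
  have hXc := prefLength_lt_append_singleton ((List.sublist_append_left _ T).trans hX)
  have hYc := prefLength_lt_append_singleton ((List.sublist_append_left _ T).trans hY)
  rw [List.append_assoc, List.singleton_append] at hX hY
  refine ⟨(cons_sublist_drop hX hXc).subset List.mem_cons_self,
    (cons_sublist_drop hY hYc).subset List.mem_cons_self, ⟨hXc, hYc⟩, ?_⟩
  rintro ⟨w, ⟨-, -, -, -, d, hdX, hdY⟩, ⟨hX₁, hY₁⟩, hX₂, hY₂⟩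
  refine hmax Z'.length (by simp) d ?_
  simpa [Shares] using
    And.intro (insert_sublist hX hX₁ hX₂ hdX) (insert_sublist hY hY₁ hY₂ hdY)

end MCSPaper
end

section
/- Under the sentinel assumptions, for any indices i and j' with 1 ≤ i ≤ |X|−1 and 1 ≤ j' ≤ |Y|, the pair (i, j') is a suff-match if and only if there exists an index j with j' < j ≤ |Y| such that Suff_{i+1}[j] ≤ |X| (i.e., (Suff_{i+1}[j], j) is a match), prev_Y(X[i], j) = j', and prev_X(X[i], Suff_{i+1}[j]) = i. -/
open scoped Classical

namespace MCSPaper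

variable {α : Type*}

/-- One coordinate of `suffPair`: the greatest 1-based index `i` such that `W[i..|W|]` contains `Z`
as a subsequence. -/
noncomputable def suffIdx (W Z : List α) : ℕ :=
  sSup {i | i ≤ W.length + 1 ∧ Z.Sublist (W.drop (i - 1))}

theorem suffPair_eq (X Y Z : List α) : suffPair X Y Z = (suffIdx X Z, suffIdx Y Z) := rfl

theorem le_suffIdx {W Z : List α} {k : ℕ} (hk : k ≤ W.length + 1)
    (h : Z.Sublist (W.drop (k - 1))) : k ≤ suffIdx W Z :=
  le_csSup ⟨W.length + 1, fun _ hx => hx.1⟩ ⟨hk, h⟩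

theorem suffIdx_spec {W Z : List α} (h : Z.Sublist W) :
    suffIdx W Z ≤ W.length + 1 ∧ Z.Sublist (W.drop (suffIdx W Z - 1)) :=
  Nat.sSup_mem (s := {i | i ≤ W.length + 1 ∧ Z.Sublist (W.drop (i - 1))})
    ⟨1, by simpa using h⟩ ⟨W.length + 1, fun _ hx => hx.1⟩

theorem one_le_suffIdx {W Z : List α} (h : Z.Sublist W) : 1 ≤ suffIdx W Z :=
  le_suffIdx (by omega) (by simpa using h)

theorem suffIdx_nil (W : List α) : suffIdx W [] = W.length + 1 :=
  le_antisymm (suffIdx_spec (List.nil_sublist W)).1 (le_suffIdx le_rfl (List.nil_sublist _))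

theorem le_prevIdx {W : List α} {c : α} {b k : ℕ} (hk : 1 ≤ k) (hkb : k < b)
    (h : W[k - 1]? = some c) : k ≤ prevIdx W c b :=
  le_csSup ⟨b, fun _ hx => hx.2.1.le⟩ ⟨hk, hkb, h⟩

theorem prevIdx_spec {W : List α} {c : α} {b : ℕ} (h : 1 ≤ prevIdx W c b) :
    prevIdx W c b < b ∧ W[prevIdx W c b - 1]? = some c := by
  have hne : {h' | 1 ≤ h' ∧ h' < b ∧ W[h' - 1]? = some c}.Nonempty := by
    by_contra hne
    rw [Set.not_nonempty_iff_eq_empty] at hne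
    simp [prevIdx, hne] at h
  exact (Nat.sSup_mem hne ⟨b, fun _ hx => hx.2.1.le⟩).2

theorem prevIdx_eq_of_lt_of_le {W : List α} {c : α} {a b i : ℕ} (h : prevIdx W c b = i)
    (hi : 1 ≤ i) (hia : i < a) (hab : a ≤ b) : prevIdx W c a = i := by
  have h1 := (prevIdx_spec (h.symm ▸ hi)).2
  rw [h] at h1
  have h2 := le_prevIdx hi hia h1
  have h3 := prevIdx_spec (hi.trans h2)
  have h4 := le_prevIdx (hi.trans h2) (h3.1.trans_le hab) h3.2
  omega

theorem exists_of_cons_sublist_drop {W Z : List α} {c : α} {k : ℕ}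
    (h : (c :: Z).Sublist (W.drop k)) :
    ∃ m, k ≤ m ∧ W[m]? = some c ∧ Z.Sublist (W.drop (m + 1)) := by
  induction W generalizing k with
  | nil => simp at h
  | cons a W ih =>
    cases k with
    | succ k =>
      obtain ⟨m, hm, h1, h2⟩ := ih (k := k) (by simpa using h)
      exact ⟨m + 1, by omega, by simpa using h1, by simpa using h2⟩
    | zero =>
      rw [List.drop_zero] at h
      cases h with
      | cons _ h =>
        obtain ⟨m, hm, h1, h2⟩ := ih (k := 0) (by simpa using h)
        exact ⟨m + 1, by omega, by simpa using h1, by simpa using h2⟩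
      | cons_cons _ h => exact ⟨0, le_rfl, by simp, by simpa using h⟩

theorem cons_sublist_drop_s18 {W Z : List α} {c : α} {m : ℕ} (hc : W[m]? = some c)
    (h : Z.Sublist (W.drop (m + 1))) : (c :: Z).Sublist (W.drop m) := by
  obtain ⟨hm, rfl⟩ := List.getElem?_eq_some_iff.1 hc
  rw [List.drop_eq_getElem_cons hm]
  exact h.cons_cons _

theorem cons_sublist_drop_prevIdx {W Z : List α} {c : α} (hZ : Z.Sublist W)
    (h : 1 ≤ prevIdx W c (suffIdx W Z)) :
    (c :: Z).Sublist (W.drop (prevIdx W c (suffIdx W Z) - 1)) := by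
  obtain ⟨h1, h2⟩ := prevIdx_spec h
  refine cons_sublist_drop_s18 h2 ((suffIdx_spec hZ).2.trans ?_)
  exact List.drop_sublist_drop_left W (by omega)

theorem suffIdx_cons {W Z : List α} {c : α} (h : (c :: Z).Sublist W) :
    prevIdx W c (suffIdx W Z) = suffIdx W (c :: Z) := by
  have hZ : Z.Sublist W := (List.sublist_cons_self c Z).trans h
  have hge : suffIdx W (c :: Z) ≤ prevIdx W c (suffIdx W Z) := by
    obtain ⟨m, hm, h1, h2⟩ := exists_of_cons_sublist_drop (suffIdx_spec h).2
    have hlt := (List.getElem?_eq_some_iff.1 h1).1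
    have h3 : m + 2 ≤ suffIdx W Z := le_suffIdx (by omega) h2
    have h4 : m + 1 ≤ prevIdx W c (suffIdx W Z) := le_prevIdx (by omega) (by omega) h1
    omega
  have hp := (one_le_suffIdx h).trans hge
  have h1 := (prevIdx_spec hp).1
  have h2 := (suffIdx_spec hZ).1
  exact le_antisymm (le_suffIdx (by omega) (cons_sublist_drop_prevIdx hZ hp)) hge

theorem cons_sublist_of_one_le_prevIdx {W Z : List α} {c : α} (hZ : Z.Sublist W)
    (h : 1 ≤ prevIdx W c (suffIdx W Z)) : (c :: Z).Sublist W :=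
  (cons_sublist_drop_prevIdx hZ h).trans (List.drop_sublist _ _)

theorem suffIdx_le_length {W Z : List α} (hZ : Z ≠ []) (h : Z.Sublist W) :
    suffIdx W Z ≤ W.length := by
  obtain ⟨c, Z, rfl⟩ := List.exists_cons_of_ne_nil hZ
  obtain ⟨m, hm, h1, -⟩ := exists_of_cons_sublist_drop (suffIdx_spec h).2
  have := (List.getElem?_eq_some_iff.1 h1).1
  omega

theorem suffIdx_singleton_of_getLast? {W : List α} {c : α} (h : W.getLast? = some c) :
    [c].Sublist W ∧ suffIdx W [c] = W.length := by
  have hs : [c].Sublist W := List.singleton_sublist.2 (List.mem_of_getLast? h)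
  refine ⟨hs, le_antisymm (suffIdx_le_length (by simp) hs) (le_suffIdx (by omega) ?_)⟩
  rw [List.getLast?_eq_getElem?] at h
  exact cons_sublist_drop_s18 h (List.nil_sublist _)

/-- A suff-match lying before the last position of `X` precedes another suff-match from which it
is obtained by prepending one character. -/
theorem IsSuffMatch.exists_succ {X Y : List α} {d c : α} (hX : X.getLast? = some d)
    (hY : Y.getLast? = some d) {i j' : ℕ} (hi : i < X.length) (hc : X[i - 1]? = some c)
    (h : IsSuffMatch X Y (i, j')) :
    ∃ a j, IsSuffMatch X Y (a, j) ∧ i < a ∧ a ≤ X.length ∧ j' < j ∧ j ≤ Y.length ∧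
      prevIdx X c a = i ∧ prevIdx Y c j = j' := by
  obtain ⟨Z, hZ, ⟨hZX, hZY⟩, hs⟩ := h
  obtain ⟨e, Z, rfl⟩ := List.exists_cons_of_ne_nil hZ
  obtain ⟨rfl, rfl⟩ := Prod.mk.inj hs
  have hpX := suffIdx_cons hZX
  have hpY := suffIdx_cons hZY
  have h1X := one_le_suffIdx hZX
  have h1Y := one_le_suffIdx hZY
  have hqX := prevIdx_spec (hpX.symm ▸ h1X)
  have hqY := prevIdx_spec (hpY.symm ▸ h1Y)
  rw [hpX] at hqX
  rw [hpY] at hqY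
  obtain rfl : e = c := Option.some.inj (hqX.2.symm.trans hc)
  have hZX' : Z.Sublist X := (List.sublist_cons_self e Z).trans hZX
  have hZY' : Z.Sublist Y := (List.sublist_cons_self e Z).trans hZY
  by_cases hnil : Z = []
  · subst hnil
    obtain ⟨hdX, hsX⟩ := suffIdx_singleton_of_getLast? hX
    obtain ⟨hdY, hsY⟩ := suffIdx_singleton_of_getLast? hY
    have hne : e ≠ d := by
      rintro rfl
      exact absurd hsX hi.ne
    have hlt : suffIdx Y [e] < Y.length := by
      refine lt_of_le_of_ne (suffIdx_le_length (by simp) hZY) fun heq => hne ?_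
      have h2 := hqY.2
      rw [List.getLast?_eq_getElem?] at hY
      change Y[suffIdx Y [e] - 1]? = some e at h2
      rw [heq, hY] at h2
      exact (Option.some.inj h2).symm
    rw [suffIdx_nil] at hpX hpY
    exact ⟨X.length, Y.length, ⟨[d], by simp, ⟨hdX, hdY⟩, by rw [suffPair_eq, hsX, hsY]⟩, hi,
      le_rfl, hlt, le_rfl, prevIdx_eq_of_lt_of_le hpX h1X hi (by omega),
      prevIdx_eq_of_lt_of_le hpY h1Y hlt (by omega)⟩
  · exact ⟨_, _, ⟨Z, hnil, ⟨hZX', hZY'⟩, rfl⟩, hqX.1, suffIdx_le_length hnil hZX', hqY.1,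
      suffIdx_le_length hnil hZY', hpX, hpY⟩

theorem IsSuffMatch.prevPair {X Y : List α} {c : α} {a j : ℕ} (h : IsSuffMatch X Y (a, j))
    (hX : 1 ≤ prevIdx X c a) (hY : 1 ≤ prevIdx Y c j) :
    IsSuffMatch X Y (prevIdx X c a, prevIdx Y c j) := by
  obtain ⟨Z, -, ⟨hZX, hZY⟩, hs⟩ := h
  obtain ⟨rfl, rfl⟩ := Prod.mk.inj hs
  have hcX := cons_sublist_of_one_le_prevIdx hZX hX
  have hcY := cons_sublist_of_one_le_prevIdx hZY hY
  exact ⟨c :: Z, by simp, ⟨hcX, hcY⟩, Prod.ext (suffIdx_cons hcX).symm (suffIdx_cons hcY).symm⟩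

theorem suffSeq_le {X Y : List α} {i a j : ℕ} (hia : i ≤ a) (ha : a ≤ X.length)
    (h : IsSuffMatch X Y (a, j)) : SuffSeq X Y i j ≤ a :=
  Nat.sInf_le (Or.inl ⟨hia, ha, h⟩)

theorem suffSeq_spec {X Y : List α} {i j : ℕ} (h : SuffSeq X Y i j ≤ X.length) :
    i ≤ SuffSeq X Y i j ∧ IsSuffMatch X Y (SuffSeq X Y i j, j) := by
  have hmem : SuffSeq X Y i j ∈
      {i' | i ≤ i' ∧ i' ≤ X.length ∧ IsSuffMatch X Y (i', j)} ∪ {X.length + 1} :=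
    Nat.sInf_mem ⟨X.length + 1, Or.inr rfl⟩
  rcases hmem with hm | hm
  · exact ⟨hm.1, hm.2.2⟩
  · rw [Set.mem_singleton_iff] at hm
    omega

theorem statement18 (X Y : List ℕ) (σ : ℕ) (hsen : Sentinel X Y σ)
    (i j' : ℕ) (hi1 : 1 ≤ i) (hi2 : i ≤ X.length - 1)
    (hj1 : 1 ≤ j') (hj2 : j' ≤ Y.length)
    (ci : ℕ) (hci : X[i - 1]? = some ci) :
    IsSuffMatch X Y (i, j') ↔
      ∃ j, j' < j ∧ j ≤ Y.length ∧ SuffSeq X Y (i + 1) j ≤ X.length ∧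
        prevIdx Y ci j = j' ∧ prevIdx X ci (SuffSeq X Y (i + 1) j) = i := by
  obtain ⟨-, -, -, -, hX, hY, -, -⟩ := hsen
  constructor
  · intro h
    obtain ⟨a, j, hm, hia, ha, hj, hjY, hpX, hpY⟩ := h.exists_succ hX hY (by omega) hci
    have hle : SuffSeq X Y (i + 1) j ≤ a := suffSeq_le hia ha hm
    exact ⟨j, hj, hjY, hle.trans ha, hpY,
      prevIdx_eq_of_lt_of_le hpX hi1 (suffSeq_spec (hle.trans ha)).1 hle⟩
  · rintro ⟨j, -, -, hle, rfl, hpX⟩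
    have hm := (suffSeq_spec hle).2.prevPair (hpX.symm ▸ hi1) hj1
    rwa [hpX] at hm

end MCSPaper
end
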